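/- Let P ∈ P_d, let φ* := log ψ*(P), and let P* be the measure on ℝ^d with P*(B) := ∫_B e^{φ*} dx for Borel sets B. If Δ : ℝ^d → [-∞, ∞) is a function such that φ* + tΔ ∈ Φ for all sufficiently small t > 0, then ∫_{ℝ^d} Δ dP ≤ ∫_{ℝ^d} Δ dP*. -/

import Mathlib

open MeasureTheory Filter Set
open scoped ENNReal Topology

noncomputable section

/-- `ℝ^d` with its Euclidean norm and Lebesgue measure. -/
abbrev Rd (d : ℕ) : Type := EuclideanSpace ℝ (Fin d)

/-- A nonnegative function is log-concave (`log f` is concave, with `log 0 := -∞`),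
expressed multiplicatively via `f x ^ (1-t) * f y ^ t ≤ f ((1-t) • x + t • y)`. -/
def IsLogConcaveFn {E : Type*} [AddCommGroup E] [Module ℝ E] (f : E → ℝ) : Prop :=
  (∀ x, 0 ≤ f x) ∧
  ∀ x y : E, ∀ t : ℝ, t ∈ Set.Icc (0:ℝ) 1 →
    f x ^ (1 - t) * f y ^ t ≤ f ((1 - t) • x + t • y)

/-- A probability density with respect to the (Lebesgue) measure of a `MeasureSpace`. -/
def IsDensity {E : Type*} [MeasureSpace E] (f : E → ℝ) : Prop :=
  (∀ x, 0 ≤ f x) ∧ Measurable f ∧ ∫⁻ x, ENNReal.ofReal (f x) = 1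

/-- Membership in the class `F_d`: an upper semi-continuous log-concave probability
density. -/
def IsLCDensity {E : Type*} [MeasureSpace E] [TopologicalSpace E] [AddCommGroup E]
    [Module ℝ E] (f : E → ℝ) : Prop :=
  IsDensity f ∧ UpperSemicontinuous f ∧ IsLogConcaveFn f

/-- Membership in the class `P_d`: probability measures with finite first moment that are
not concentrated on any affine hyperplane `{x | l x = c}` (`l` a nonzero linear
functional). -/
def MemP {E : Type*} [NormedAddCommGroup E] [NormedSpace ℝ E] [MeasureSpace E]
    (P : Measure E) : Prop :=
  IsProbabilityMeasure P ∧ Integrable (fun x => ‖x‖) P ∧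
  ∀ (l : E →ₗ[ℝ] ℝ) (c : ℝ), l ≠ 0 → P {x | l x = c} < 1

/-- The log-concave projection predicate: `fs ∈ F_d` maximises `∫ log f dP` over `F_d`
(candidates whose objective is `-∞`, i.e. that vanish on a set of positive `P`-measure or
have non-integrable logarithm, are trivially dominated). -/
def IsLCProj {E : Type*} [NormedAddCommGroup E] [NormedSpace ℝ E] [MeasureSpace E]
    (P : Measure E) (fs : E → ℝ) : Prop :=
  IsLCDensity fs ∧ (∀ᵐ x ∂P, 0 < fs x) ∧ Integrable (fun x => Real.log (fs x)) P ∧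
  ∀ g : E → ℝ, IsLCDensity g → (∀ᵐ x ∂P, 0 < g x) →
    Integrable (fun x => Real.log (g x)) P →
    ∫ x, Real.log (g x) ∂P ≤ ∫ x, Real.log (fs x) ∂P

/-- `log y` with values in `[-∞, ∞)`, with the convention `log 0 := -∞`. -/
def elog (y : ℝ) : EReal := if y ≤ 0 then ⊥ else ((Real.log y : ℝ) : EReal)

/-- Positive part of an extended real number, as an `ℝ≥0∞`. -/
def epos (a : EReal) : ℝ≥0∞ := if a = ⊤ then ⊤ else ENNReal.ofReal a.toReal

/-- `e^a` for an extended real `a`, valued in `[0,∞]`. -/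
def expE (a : EReal) : ℝ≥0∞ :=
  if a = ⊥ then 0 else if a = ⊤ then ⊤ else ENNReal.ofReal (Real.exp a.toReal)

/-- Integral of an `EReal`-valued function: positive part minus negative part. -/
def erealIntegral {α : Type*} [MeasurableSpace α] (P : Measure α) (φ : α → EReal) : EReal :=
  ((∫⁻ x, epos (φ x) ∂P : ℝ≥0∞) : EReal) - ((∫⁻ x, epos (-(φ x)) ∂P : ℝ≥0∞) : EReal)

/-- The class `Φ`: upper semi-continuous, concave functions `φ : E → [-∞, ∞)` with
`φ(x) → -∞` as `‖x‖ → ∞`. -/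
def MemPhi {E : Type*} [NormedAddCommGroup E] [NormedSpace ℝ E] (φ : E → EReal) : Prop :=
  (∀ x, φ x ≠ ⊤) ∧ UpperSemicontinuous φ ∧
  (∀ x y : E, ∀ t : ℝ, t ∈ Set.Icc (0:ℝ) 1 →
    (((1 - t : ℝ)) : EReal) * φ x + ((t : ℝ) : EReal) * φ y ≤ φ ((1 - t) • x + t • y)) ∧
  Tendsto φ (Filter.comap (fun x => ‖x‖) Filter.atTop) (nhds ⊥)

/-- The functional `L(φ, P) = ∫ φ dP - ∫ e^φ dx`. -/
def Lfun {E : Type*} [NormedAddCommGroup E] [NormedSpace ℝ E] [MeasureSpace E]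
    (φ : E → EReal) (P : Measure E) : EReal :=
  erealIntegral P φ - ((∫⁻ x, expE (φ x) : ℝ≥0∞) : EReal)

/-- `L*(P) = sup_{φ ∈ Φ} L(φ, P)`. -/
def Lstar {E : Type*} [NormedAddCommGroup E] [NormedSpace ℝ E] [MeasureSpace E]
    (P : Measure E) : EReal :=
  ⨆ (φ : E → EReal) (_ : MemPhi φ), Lfun φ P

/-- Action of a matrix on a Euclidean vector. -/
def mulVE {m d : ℕ} (A : Matrix (Fin m) (Fin d) ℝ) (x : Rd d) : Rd m :=
  (WithLp.equiv 2 (Fin m → ℝ)).symm (A.mulVec ((WithLp.equiv 2 (Fin d → ℝ)) x))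

section

variable {E : Type*} [NormedAddCommGroup E] [NormedSpace ℝ E]

lemma MemPhi.coe_le {φ : E → EReal} (hφ : MemPhi φ) {x y : E} {a b t : ℝ}
    (hx : φ x = a) (hy : φ y = b) (ht : t ∈ Icc (0:ℝ) 1) :
    (((1 - t) * a + t * b : ℝ) : EReal) ≤ φ ((1 - t) • x + t • y) := by
  have h := hφ.2.2.1 x y t ht
  rw [hx, hy] at h
  exact_mod_cast h

lemma MemPhi.exists_eq_coe {φ : E → EReal} (hφ : MemPhi φ) {x : E} (hx : φ x ≠ ⊥) :
    ∃ r : ℝ, φ x = r :=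
  ⟨(φ x).toReal, (EReal.coe_toReal (hφ.1 x) hx).symm⟩

lemma MemPhi.convex_ne_bot {φ : E → EReal} (hφ : MemPhi φ) : Convex ℝ {x | φ x ≠ ⊥} := by
  intro x hx y hy a b ha hb hab
  obtain ⟨r, hr⟩ := hφ.exists_eq_coe hx
  obtain ⟨s, hs⟩ := hφ.exists_eq_coe hy
  obtain rfl : a = 1 - b := by linarith
  exact ne_bot_of_le_ne_bot (EReal.coe_ne_bot _) (hφ.coe_le hr hs ⟨hb, by linarith⟩)

/-- A coercive concave function is dominated by an affine function of the norm. -/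
lemma MemPhi.exists_le_sub_mul_norm [FiniteDimensional ℝ E] {φ : E → EReal} (hφ : MemPhi φ) :
    ∃ a b : ℝ, 0 < a ∧ ∀ x, φ x ≤ ((b - a * ‖x‖ : ℝ) : EReal) := by
  by_cases hbot : ∀ x, φ x = ⊥
  · exact ⟨1, 0, one_pos, fun x => by simp [hbot x]⟩
  push Not at hbot
  obtain ⟨x₀, hx₀⟩ := hbot
  obtain ⟨c, hc⟩ := hφ.exists_eq_coe hx₀
  have hev : ∀ᶠ x in comap (fun x : E => ‖x‖) atTop, φ x < ((c - 1 : ℝ) : EReal) :=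
    hφ.2.2.2.eventually (gt_mem_nhds (EReal.bot_lt_coe _))
  rw [eventually_comap] at hev
  obtain ⟨R₀, hR₀⟩ := eventually_atTop.1 hev
  set R : ℝ := |R₀| + ‖x₀‖ + 1 with hR
  have hRpos : 0 < R := by positivity
  have hfar : ∀ x, R ≤ ‖x - x₀‖ → φ x ≤ ((c - ‖x - x₀‖ / R : ℝ) : EReal) := by
    intro x hx
    by_cases hxb : φ x = ⊥
    · simp [hxb]
    obtain ⟨r, hr⟩ := hφ.exists_eq_coe hxb
    have hn : 0 < ‖x - x₀‖ := hRpos.trans_le hx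
    set s : ℝ := R / ‖x - x₀‖ with hs
    have hs0 : 0 < s := by positivity
    have hs1 : s ≤ 1 := (div_le_one hn).2 hx
    have h1 := hφ.coe_le hc hr ⟨hs0.le, hs1⟩
    have hy : ‖((1 - s) • x₀ + s • x) - x₀‖ = R := by
      have : ((1 - s) • x₀ + s • x) - x₀ = s • (x - x₀) := by module
      rw [this, norm_smul, Real.norm_of_nonneg hs0.le, hs, div_mul_cancel₀ _ hn.ne']
    have hy2 : R₀ ≤ ‖(1 - s) • x₀ + s • x‖ := by
      have := norm_sub_le ((1 - s) • x₀ + s • x) x₀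
      rw [hy] at this
      linarith [le_abs_self R₀]
    have h2 := h1.trans (hR₀ _ hy2 _ rfl).le
    rw [EReal.coe_le_coe_iff] at h2
    rw [hr, EReal.coe_le_coe_iff]
    have h3 : s * r ≤ s * (c - ‖x - x₀‖ / R) := by
      have : s * (‖x - x₀‖ / R) = 1 := by rw [hs]; field_simp
      rw [mul_sub, this]
      linarith
    exact le_of_mul_le_mul_left h3 hs0
  obtain ⟨m, -, hm⟩ := UpperSemicontinuousOn.exists_isMaxOn
    (⟨x₀, Metric.mem_closedBall_self hRpos.le⟩ : (Metric.closedBall x₀ R).Nonempty)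
    (isCompact_closedBall x₀ R) (hφ.2.1.upperSemicontinuousOn _)
  have hxm : φ x₀ ≤ φ m := hm (Metric.mem_closedBall_self hRpos.le)
  obtain ⟨M, hM⟩ := hφ.exists_eq_coe (ne_bot_of_le_ne_bot hx₀ hxm)
  have hcM : c ≤ M := by rwa [hc, hM, EReal.coe_le_coe_iff] at hxm
  refine ⟨1 / R, M + 1 + ‖x₀‖ / R, by positivity, fun x => ?_⟩
  have htri : ‖x‖ / R ≤ ‖x - x₀‖ / R + ‖x₀‖ / R := by
    rw [← add_div]
    gcongr
    simpa using norm_add_le (x - x₀) x₀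
  rcases le_total R ‖x - x₀‖ with h | h
  · refine (hfar x h).trans (EReal.coe_le_coe_iff.2 ?_)
    rw [one_div_mul_eq_div]
    linarith
  · have : φ x ≤ φ m := hm (mem_closedBall_iff_norm.2 h)
    refine (this.trans hM.le).trans (EReal.coe_le_coe_iff.2 ?_)
    have : ‖x - x₀‖ / R ≤ 1 := (div_le_one hRpos).2 h
    rw [one_div_mul_eq_div]
    linarith

lemma integrable_exp_neg_mul_norm [FiniteDimensional ℝ E] [MeasurableSpace E] [BorelSpace E]
    (μ : Measure E) [μ.IsAddHaarMeasure] {a : ℝ} (ha : 0 < a) :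
    Integrable (fun x : E => Real.exp (-(a * ‖x‖))) μ := by
  set k := Module.finrank ℝ E + 1 with hk
  have hint : Integrable (fun x : E => (1 + ‖x‖) ^ (-(k : ℝ))) μ :=
    integrable_one_add_norm (by simp [hk])
  refine (hint.const_mul (Real.exp a * k.factorial / a ^ k)).mono'
    (by fun_prop) (Eventually.of_forall fun x => ?_)
  have h := Real.pow_div_factorial_le_exp (a * (1 + ‖x‖)) (by positivity) k
  rw [Real.norm_of_nonneg (Real.exp_pos _).le, Real.rpow_neg (by positivity), Real.rpow_natCast]
  have hexp : Real.exp (-(a * ‖x‖)) = Real.exp a / Real.exp (a * (1 + ‖x‖)) := by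
    rw [← Real.exp_sub]; ring_nf
  rw [hexp, div_le_iff₀ (Real.exp_pos _)]
  calc Real.exp a = Real.exp a * k.factorial / a ^ k * ((1 + ‖x‖) ^ k)⁻¹ *
        ((a * (1 + ‖x‖)) ^ k / k.factorial) := by
        have : (0:ℝ) < k.factorial := by positivity
        have : 0 < 1 + ‖x‖ := by positivity
        rw [mul_pow]
        field_simp
    _ ≤ _ := by gcongr

lemma expE_coe (r : ℝ) : expE (r : EReal) = ENNReal.ofReal (Real.exp r) := by
  simp [expE]

lemma expE_bot : expE ⊥ = 0 := by simp [expE]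

lemma expE_ne_top {a : EReal} (ha : a ≠ ⊤) : expE a ≠ ⊤ := by
  induction a with
  | bot => simp [expE_bot]
  | coe r => simp [expE_coe]
  | top => exact absurd rfl ha

lemma expE_le_of_le_coe {a : EReal} {r : ℝ} (h : a ≤ r) :
    expE a ≤ ENNReal.ofReal (Real.exp r) := by
  induction a with
  | bot => simp [expE_bot]
  | coe s =>
    rw [expE_coe]
    exact ENNReal.ofReal_le_ofReal (Real.exp_le_exp.2 (EReal.coe_le_coe_iff.1 h))
  | top => simp at h

lemma measurable_expE : Measurable expE := by
  unfold expE
  refine Measurable.ite (measurableSet_singleton _) measurable_const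
    (Measurable.ite (measurableSet_singleton _) measurable_const ?_)
  exact (Real.measurable_exp.comp measurable_ereal_toReal).ennreal_ofReal

lemma MemPhi.measurable [MeasurableSpace E] [BorelSpace E] {φ : E → EReal} (hφ : MemPhi φ) :
    Measurable φ :=
  hφ.2.1.measurable

lemma MemPhi.measurable_expE [MeasurableSpace E] [BorelSpace E] {φ : E → EReal} (hφ : MemPhi φ) :
    Measurable fun x => expE (φ x) :=
  _root_.measurable_expE.comp hφ.measurable

lemma MemPhi.lintegral_expE_ne_top [FiniteDimensional ℝ E] [MeasurableSpace E] [BorelSpace E]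
    (μ : Measure E) [μ.IsAddHaarMeasure] {φ : E → EReal} (hφ : MemPhi φ) :
    ∫⁻ x, expE (φ x) ∂μ ≠ ⊤ := by
  obtain ⟨a, b, ha, hab⟩ := hφ.exists_le_sub_mul_norm
  have hint := (integrable_exp_neg_mul_norm μ ha).const_mul (Real.exp b)
  refine ne_top_of_le_ne_top hint.lintegral_lt_top.ne (lintegral_mono fun x => ?_)
  rw [← Real.exp_add, ← sub_eq_add_neg]
  exact expE_le_of_le_coe (hab x)

/-- A convex set of full measure for some `P` in the class `P_d` is not Lebesgue-null. -/
lemma MemP.volume_ne_zero_of_convex [FiniteDimensional ℝ E] [MeasureSpace E] [BorelSpace E]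
    [(volume : Measure E).IsAddHaarMeasure] {P : Measure E} (hP : MemP P) {C : Set E}
    (hC : Convex ℝ C) (hPC : ∀ᵐ x ∂P, x ∈ C) : volume C ≠ 0 := by
  have := hP.1
  suffices h : (interior C).Nonempty from
    ((isOpen_interior.measure_pos volume h).trans_le (measure_mono interior_subset)).ne'
  rw [hC.interior_nonempty_iff_affineSpan_eq_top]
  obtain ⟨x₀, hx₀⟩ := hPC.exists
  by_contra hspan
  have hdir : (affineSpan ℝ C).direction ≠ ⊤ := fun h =>
    hspan ((AffineSubspace.direction_eq_top_iff_of_nonempty ⟨x₀, subset_affineSpan ℝ C hx₀⟩).1 h)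
  obtain ⟨l, hl, hker⟩ := Submodule.exists_le_ker_of_lt_top _ hdir.lt_top
  refine (hP.2.2 l (l x₀) hl).ne ?_
  refine le_antisymm prob_le_one ?_
  have : ∀ᵐ x ∂P, l x = l x₀ := by
    filter_upwards [hPC] with x hx
    have hv : x -ᵥ x₀ ∈ (affineSpan ℝ C).direction :=
      AffineSubspace.vsub_mem_direction (subset_affineSpan ℝ C hx) (subset_affineSpan ℝ C hx₀)
    have := hker hv
    rw [LinearMap.mem_ker, vsub_eq_sub, map_sub] at this
    linarith
  exact ((measure_congr (eventuallyEq_univ.2 this)).trans measure_univ).ge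

lemma MemPhi.isLCDensity [FiniteDimensional ℝ E] [MeasureSpace E] [BorelSpace E]
    [(volume : Measure E).IsAddHaarMeasure] {φ : E → EReal} (hφ : MemPhi φ)
    (h0 : ∫⁻ x, expE (φ x) ≠ 0) :
    IsLCDensity fun x => (expE (φ x)).toReal / (∫⁻ x, expE (φ x)).toReal := by
  have htop := hφ.lintegral_expE_ne_top volume
  set Z := ∫⁻ x, expE (φ x) with hZ
  have hZpos : 0 < Z.toReal := ENNReal.toReal_pos h0 htop
  have hnn : ∀ x, 0 ≤ (expE (φ x)).toReal / Z.toReal := fun x => by positivity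
  refine ⟨⟨hnn, ?_, ?_⟩, ?_, hnn, ?_⟩
  · exact (hφ.measurable_expE.ennreal_toReal).div_const _
  · have : ∀ x, ENNReal.ofReal ((expE (φ x)).toReal / Z.toReal) = expE (φ x) / Z := fun x => by
      rw [ENNReal.ofReal_div_of_pos hZpos, ENNReal.ofReal_toReal (expE_ne_top (hφ.1 x)),
        ENNReal.ofReal_toReal htop]
    simp_rw [this, div_eq_mul_inv]
    rw [lintegral_mul_const _ hφ.measurable_expE, ← hZ,
      ENNReal.mul_inv_cancel h0 htop]
  · intro x y hy
    have hy0 : 0 < y := (hnn x).trans_lt hy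
    have key : ∀ z, (expE (φ z)).toReal / Z.toReal < y ↔
        φ z < ((Real.log (y * Z.toReal) : ℝ) : EReal) := fun z => by
      rw [div_lt_iff₀ hZpos]
      by_cases hz : φ z = ⊥
      · simp [hz, expE_bot, EReal.bot_lt_coe, hy0, hZpos]
      · obtain ⟨r, hr⟩ := hφ.exists_eq_coe hz
        rw [hr, expE_coe, ENNReal.toReal_ofReal (Real.exp_pos _).le, EReal.coe_lt_coe_iff,
          Real.lt_log_iff_exp_lt (by positivity)]
    filter_upwards [hφ.2.1 x _ ((key x).1 hy)] with z hz using (key z).2 hz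
  · intro x y t ht
    rcases eq_or_ne t 0 with rfl | ht0
    · simp
    rcases eq_or_ne t 1 with rfl | ht1
    · simp
    have h1t : 1 - t ≠ 0 := sub_ne_zero.2 ht1.symm
    by_cases hx : φ x = ⊥
    · simp only [hx, expE_bot, ENNReal.toReal_zero, zero_div, Real.zero_rpow h1t, zero_mul]
      exact hnn _
    by_cases hy : φ y = ⊥
    · simp only [hy, expE_bot, ENNReal.toReal_zero, zero_div, Real.zero_rpow ht0, mul_zero]
      exact hnn _
    obtain ⟨a, ha⟩ := hφ.exists_eq_coe hx
    obtain ⟨b, hb⟩ := hφ.exists_eq_coe hy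
    have hab := hφ.coe_le ha hb ht
    obtain ⟨c, hc⟩ := hφ.exists_eq_coe (ne_bot_of_le_ne_bot (EReal.coe_ne_bot _) hab)
    rw [hc, EReal.coe_le_coe_iff] at hab
    simp only [ha, hb, hc, expE_coe, ENNReal.toReal_ofReal (Real.exp_pos _).le]
    rw [Real.div_rpow (Real.exp_pos _).le hZpos.le, Real.div_rpow (Real.exp_pos _).le hZpos.le,
      div_mul_div_comm, ← Real.rpow_add hZpos, ← Real.exp_mul, ← Real.exp_mul, ← Real.exp_add,
      sub_add_cancel, Real.rpow_one]
    gcongr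
    linarith

lemma IsLCProj.integral_toReal_sub_log_le [FiniteDimensional ℝ E] [MeasureSpace E] [BorelSpace E]
    [(volume : Measure E).IsAddHaarMeasure] {P : Measure E} (hP : MemP P) {fs : E → ℝ}
    (hfs : IsLCProj P fs) {φ : E → EReal} (hφ : MemPhi φ) (hbot : ∀ᵐ x ∂P, φ x ≠ ⊥)
    (hint : Integrable (fun x => (φ x).toReal) P) :
    0 < (∫⁻ x, expE (φ x)).toReal ∧
    ∫ x, (φ x).toReal ∂P - Real.log (∫⁻ x, expE (φ x)).toReal ≤ ∫ x, Real.log (fs x) ∂P := by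
  have := hP.1
  have h0 : ∫⁻ x, expE (φ x) ≠ 0 := by
    intro h
    rw [lintegral_eq_zero_iff hφ.measurable_expE] at h
    refine hP.volume_ne_zero_of_convex hφ.convex_ne_bot hbot ?_
    refine measure_mono_null (fun x (hx : φ x ≠ ⊥) => ?_) h
    obtain ⟨r, hr⟩ := hφ.exists_eq_coe hx
    simp [hr, expE_coe, Real.exp_pos]
  have hZpos := ENNReal.toReal_pos h0 (hφ.lintegral_expE_ne_top volume)
  refine ⟨hZpos, ?_⟩
  have hlog : (fun x => (φ x).toReal - Real.log (∫⁻ x, expE (φ x)).toReal) =ᵐ[P]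
      fun x => Real.log ((expE (φ x)).toReal / (∫⁻ x, expE (φ x)).toReal) := by
    filter_upwards [hbot] with x hx
    obtain ⟨r, hr⟩ := hφ.exists_eq_coe hx
    rw [hr, expE_coe, ENNReal.toReal_ofReal (Real.exp_pos _).le,
      Real.log_div (Real.exp_pos _).ne' hZpos.ne', Real.log_exp, EReal.toReal_coe]
  have h := hfs.2.2.2 _ (hφ.isLCDensity h0) ?_ ((hint.sub (integrable_const _)).congr hlog)
  · rwa [← integral_congr_ae hlog, integral_sub hint (integrable_const _), integral_const,
      probReal_univ, one_smul] at h
  · filter_upwards [hbot] with x hx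
    obtain ⟨r, hr⟩ := hφ.exists_eq_coe hx
    rw [hr, expE_coe, ENNReal.toReal_ofReal (Real.exp_pos _).le]
    exact div_pos (Real.exp_pos _) hZpos

end

lemma epos_coe (r : ℝ) : epos (r : EReal) = ENNReal.ofReal r := by simp [epos]

lemma measurable_epos : Measurable epos := by
  unfold epos
  exact Measurable.ite (measurableSet_singleton _) measurable_const
    measurable_ereal_toReal.ennreal_ofReal

lemma erealIntegral_congr_ae {α : Type*} [MeasurableSpace α] {μ : Measure α} {f g : α → EReal}
    (h : f =ᵐ[μ] g) : erealIntegral μ f = erealIntegral μ g := by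
  unfold erealIntegral
  have h₁ : ∫⁻ x, epos (f x) ∂μ = ∫⁻ x, epos (g x) ∂μ := lintegral_congr_ae (h.fun_comp epos)
  have h₂ : ∫⁻ x, epos (-f x) ∂μ = ∫⁻ x, epos (-g x) ∂μ :=
    lintegral_congr_ae (h.fun_comp fun a => epos (-a))
  rw [h₁, h₂]

lemma erealIntegral_coe {α : Type*} [MeasurableSpace α] {μ : Measure α} {f : α → ℝ}
    (hf : Integrable f μ) : erealIntegral μ (fun x => (f x : EReal)) = (∫ x, f x ∂μ : ℝ) := by
  have h1 : ∫⁻ x, ENNReal.ofReal (f x) ∂μ ≠ ⊤ := hf.lintegral_lt_top.ne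
  have h2 : ∫⁻ x, ENNReal.ofReal (-f x) ∂μ ≠ ⊤ := hf.neg.lintegral_lt_top.ne
  rw [integral_eq_lintegral_pos_part_sub_lintegral_neg_part hf]
  simp only [erealIntegral, ← EReal.coe_neg, epos_coe, EReal.coe_sub]
  rw [EReal.coe_ennreal_toReal h1, EReal.coe_ennreal_toReal h2]

/-- The difference quotient `(e^{tz} - 1) / t`, with `e^{-∞} := 0`. -/
def expQuot (t : ℝ) (z : EReal) : ℝ := ((if z = ⊥ then 0 else Real.exp (t * z.toReal)) - 1) / t

lemma measurable_expQuot (t : ℝ) : Measurable (expQuot t) := by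
  unfold expQuot
  refine Measurable.div_const (Measurable.sub_const (Measurable.ite (measurableSet_singleton _)
    measurable_const ?_) _) _
  exact Real.measurable_exp.comp (measurable_ereal_toReal.const_mul t)

lemma expQuot_coe (t r : ℝ) : expQuot t r = (Real.exp (t * r) - 1) / t := by simp [expQuot]

lemma expQuot_bot (t : ℝ) : expQuot t ⊥ = -t⁻¹ := by simp [expQuot, neg_div]

lemma expQuot_mono {s t : ℝ} (hs : 0 < s) (hst : s ≤ t) (z : EReal) :
    expQuot s z ≤ expQuot t z := by
  have ht := hs.trans_le hst
  by_cases hz : z = ⊥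
  · rw [hz, expQuot_bot, expQuot_bot]
    exact neg_le_neg (inv_anti₀ hs hst)
  simp only [expQuot, if_neg hz]
  set r := z.toReal
  have hc := convexOn_exp.2 (mem_univ (t * r)) (mem_univ 0) (div_pos hs ht).le
    (sub_nonneg.2 ((div_le_one ht).2 hst)) (by ring)
  simp only [smul_eq_mul, mul_zero, add_zero, Real.exp_zero, mul_one] at hc
  rw [← mul_assoc, div_mul_cancel₀ _ ht.ne'] at hc
  rw [div_le_iff₀ hs]
  calc Real.exp (s * r) - 1 ≤ s / t * Real.exp (t * r) + (1 - s / t) - 1 := by linarith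
    _ = _ := by ring

lemma le_expQuot_coe {t : ℝ} (ht : 0 < t) (r : ℝ) : r ≤ expQuot t r := by
  rw [expQuot_coe, le_div_iff₀ ht]
  linarith [Real.add_one_le_exp (t * r)]

lemma tendsto_expQuot_coe (r : ℝ) : Tendsto (fun t => expQuot t r) (𝓝[>] 0) (𝓝 r) := by
  have h : HasDerivAt (fun t : ℝ => Real.exp (t * r)) r 0 := by
    simpa using ((hasDerivAt_id (0:ℝ)).mul_const r).exp
  have := (hasDerivWithinAt_iff_tendsto_slope' self_notMem_Ioi).1 (h.hasDerivWithinAt (s := Ioi 0))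
  refine this.congr fun t => ?_
  simp [slope_def_field, expQuot_coe]

lemma tendsto_expQuot_bot : Tendsto (fun t => expQuot t ⊥) (𝓝[>] 0) atBot := by
  simp_rw [expQuot_bot]
  exact tendsto_neg_atTop_atBot.comp tendsto_inv_nhdsGT_zero

/-- A uniform lower bound on the integrals of the difference quotients of `t ↦ e^{tΔ}` passes to
the derivative at `0`. -/
lemma le_integral_toReal_of_le_integral_expQuot {α : Type*} [MeasurableSpace α] {μ : Measure α}
    {Δ : α → EReal} (hΔ : Measurable Δ) (htop : ∀ᵐ x ∂μ, Δ x ≠ ⊤) {t₁ I : ℝ} (ht₁ : 0 < t₁)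
    (hint : ∀ t, 0 < t → t ≤ t₁ → Integrable (fun x => expQuot t (Δ x)) μ)
    (hle : ∀ t, 0 < t → t ≤ t₁ → I ≤ ∫ x, expQuot t (Δ x) ∂μ) :
    (∀ᵐ x ∂μ, Δ x ≠ ⊥) ∧ Integrable (fun x => (Δ x).toReal) μ ∧ I ≤ ∫ x, (Δ x).toReal ∂μ := by
  set u : ℕ → ℝ := fun n => t₁ / (n + 1) with hu
  have hupos : ∀ n, 0 < u n := fun n => by positivity
  have hule : ∀ n, u n ≤ t₁ := fun n => div_le_self ht₁.le (by simp)
  have hulim : Tendsto u atTop (𝓝[>] 0) := by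
    refine tendsto_nhdsWithin_iff.2 ⟨?_, Eventually.of_forall hupos⟩
    exact (tendsto_const_nhds.div_atTop (tendsto_natCast_atTop_atTop.atTop_add tendsto_const_nhds))
  set F : ℕ → α → ℝ≥0∞ := fun n x =>
    ENNReal.ofReal (expQuot t₁ (Δ x) - expQuot (u n) (Δ x)) with hF
  set G : α → ℝ≥0∞ := fun x =>
    if Δ x = ⊥ then ⊤ else ENNReal.ofReal (expQuot t₁ (Δ x) - (Δ x).toReal) with hG
  have hFm : ∀ n, Measurable (F n) := fun n =>
    (((measurable_expQuot _).comp hΔ).sub ((measurable_expQuot _).comp hΔ)).ennreal_ofReal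
  have hGm : Measurable G := by
    refine Measurable.ite (hΔ (measurableSet_singleton _)) measurable_const ?_
    exact (((measurable_expQuot _).comp hΔ).sub
      (measurable_ereal_toReal.comp hΔ)).ennreal_ofReal
  have hFint : ∀ n, ∫⁻ x, F n x ∂μ ≤
      ENNReal.ofReal (∫ x, expQuot t₁ (Δ x) ∂μ - I) := fun n => by
    have hi : Integrable (fun x => expQuot t₁ (Δ x) - expQuot (u n) (Δ x)) μ :=
      (hint t₁ ht₁ le_rfl).sub (hint _ (hupos n) (hule n))
    simp only [hF]
    rw [← ofReal_integral_eq_lintegral_ofReal hi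
      (Eventually.of_forall fun x => sub_nonneg.2 (expQuot_mono (hupos n) (hule n) _)),
      integral_sub (hint t₁ ht₁ le_rfl) (hint _ (hupos n) (hule n))]
    exact ENNReal.ofReal_le_ofReal (sub_le_sub_left (hle _ (hupos n) (hule n)) _)
  have hlim : ∀ᵐ x ∂μ, liminf (fun n => F n x) atTop = G x := by
    filter_upwards [htop] with x hx
    refine Tendsto.liminf_eq ?_
    by_cases hb : Δ x = ⊥
    · simp only [hF, hG, hb, if_true]
      refine ENNReal.tendsto_ofReal_atTop.comp (tendsto_atTop_add_const_left _ _ ?_)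
      exact tendsto_neg_atBot_atTop.comp (tendsto_expQuot_bot.comp hulim)
    · simp only [hF, hG, if_neg hb]
      refine ENNReal.tendsto_ofReal (tendsto_const_nhds.sub ?_)
      have := (tendsto_expQuot_coe (Δ x).toReal).comp hulim
      rwa [EReal.coe_toReal hx hb] at this
  have hGle : ∫⁻ x, G x ∂μ ≤ ENNReal.ofReal (∫ x, expQuot t₁ (Δ x) ∂μ - I) := by
    rw [← lintegral_congr_ae hlim]
    exact (lintegral_liminf_le hFm).trans
      (liminf_le_of_frequently_le' (Frequently.of_forall hFint))
  have hbot : ∀ᵐ x ∂μ, Δ x ≠ ⊥ := by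
    filter_upwards [ae_lt_top hGm (ne_top_of_le_ne_top ENNReal.ofReal_ne_top hGle)] with x hx hb
    simp [hG, hb] at hx
  have hGeq : ∫⁻ x, G x ∂μ = ∫⁻ x, ENNReal.ofReal (expQuot t₁ (Δ x) - (Δ x).toReal) ∂μ := by
    refine lintegral_congr_ae ?_
    filter_upwards [hbot] with x hx
    simp [hG, hx]
  have hnn : 0 ≤ᵐ[μ] fun x => expQuot t₁ (Δ x) - (Δ x).toReal := by
    filter_upwards [htop, hbot] with x hx hb
    have := le_expQuot_coe ht₁ (Δ x).toReal
    rw [EReal.coe_toReal hx hb] at this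
    exact sub_nonneg.2 this
  rw [hGeq] at hGle
  have hi : Integrable (fun x => expQuot t₁ (Δ x) - (Δ x).toReal) μ := by
    refine ⟨(((measurable_expQuot _).comp hΔ).sub
      (measurable_ereal_toReal.comp hΔ)).aestronglyMeasurable, ?_⟩
    rw [hasFiniteIntegral_iff_ofReal hnn]
    exact hGle.trans_lt ENNReal.ofReal_lt_top
  have hD : Integrable (fun x => (Δ x).toReal) μ :=
    ((hint t₁ ht₁ le_rfl).sub hi).congr (Eventually.of_forall fun x => sub_sub_cancel _ _)
  refine ⟨hbot, hD, ?_⟩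
  rw [← ofReal_integral_eq_lintegral_ofReal hi hnn, ENNReal.ofReal_le_ofReal_iff
    (sub_nonneg.2 (hle t₁ ht₁ le_rfl)), integral_sub (hint t₁ ht₁ le_rfl) hD] at hGle
  linarith

lemma elog_of_pos {y : ℝ} (hy : 0 < y) : elog y = Real.log y := if_neg hy.not_ge

lemma erealIntegral_eq_integral_toReal {α : Type*} [MeasurableSpace α] {μ : Measure α}
    {f : α → EReal} (htop : ∀ᵐ x ∂μ, f x ≠ ⊤) (hbot : ∀ᵐ x ∂μ, f x ≠ ⊥)
    (hf : Integrable (fun x => (f x).toReal) μ) :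
    erealIntegral μ f = (∫ x, (f x).toReal ∂μ : ℝ) := by
  rw [← erealIntegral_coe hf]
  refine erealIntegral_congr_ae ?_
  filter_upwards [htop, hbot] with x h1 h2 using (EReal.coe_toReal h1 h2).symm

section

variable {E : Type*} [NormedAddCommGroup E] [NormedSpace ℝ E]

lemma MemPhi.ne_top_of_pos {f : E → ℝ} {Δ : E → EReal} {t : ℝ} (ht : 0 < t)
    (h : MemPhi fun x => elog (f x) + (t : EReal) * Δ x) {x : E} (hx : 0 < f x) : Δ x ≠ ⊤ := by
  intro hΔ
  refine h.1 x ?_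
  simp [hΔ, elog_of_pos hx, EReal.coe_mul_top_of_pos ht]

/-- Integral of the difference quotient against the measure with density `f`. -/
lemma IsLCDensity.integral_expQuot [FiniteDimensional ℝ E] [MeasureSpace E] [BorelSpace E]
    [(volume : Measure E).IsAddHaarMeasure] {f : E → ℝ} (hf : IsLCDensity f) {Δ : E → EReal}
    (hΔ : Measurable Δ) {t : ℝ} (ht : 0 < t)
    (h : MemPhi fun x => elog (f x) + (t : EReal) * Δ x) :
    Integrable (fun x => expQuot t (Δ x)) (volume.withDensity fun x => ENNReal.ofReal (f x)) ∧
    ∫ x, expQuot t (Δ x) ∂(volume.withDensity fun x => ENNReal.ofReal (f x)) =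
      ((∫⁻ x, expE (elog (f x) + (t : EReal) * Δ x)).toReal - 1) / t := by
  set μ := (volume : Measure E).withDensity fun x => ENNReal.ofReal (f x) with hμ
  have hprob : IsProbabilityMeasure μ := ⟨by
    rw [hμ, withDensity_apply _ MeasurableSet.univ, Measure.restrict_univ, hf.1.2.2]⟩
  set g : E → ℝ := fun x => if Δ x = ⊥ then 0 else Real.exp (t * (Δ x).toReal) with hg
  have hgm : Measurable g := Measurable.ite (hΔ (measurableSet_singleton _)) measurable_const
    (Real.measurable_exp.comp ((measurable_ereal_toReal.comp hΔ).const_mul t))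
  have hgnn : ∀ x, 0 ≤ g x := fun x => by
    simp only [hg]
    split_ifs <;> positivity
  have hlint : ∫⁻ x, ENNReal.ofReal (g x) ∂μ = ∫⁻ x, expE (elog (f x) + (t : EReal) * Δ x) := by
    rw [hμ, lintegral_withDensity_eq_lintegral_mul _ hf.1.2.1.ennreal_ofReal hgm.ennreal_ofReal]
    refine lintegral_congr fun x => ?_
    rw [Pi.mul_apply]
    rcases (hf.1.1 x).eq_or_lt with h0 | h0
    · simp [← h0, elog, expE_bot]
    rw [elog_of_pos h0]
    by_cases hb : Δ x = ⊥
    · simp [hg, hb, EReal.coe_mul_bot_of_pos ht, expE_bot]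
    · have hx : Δ x = ((Δ x).toReal : EReal) :=
        (EReal.coe_toReal (h.ne_top_of_pos ht h0) hb).symm
      rw [hx, ← EReal.coe_mul, ← EReal.coe_add, expE_coe, Real.exp_add, Real.exp_log h0,
        ENNReal.ofReal_mul h0.le]
      simp [hg, hb]
  have hgi : Integrable g μ := by
    refine ⟨hgm.aestronglyMeasurable, ?_⟩
    rw [hasFiniteIntegral_iff_ofReal (Eventually.of_forall hgnn), hlint]
    exact (h.lintegral_expE_ne_top volume).lt_top
  refine ⟨(hgi.sub (integrable_const 1)).div_const t, ?_⟩
  change ∫ x, (g x - 1) / t ∂μ = _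
  rw [integral_div, integral_sub hgi (integrable_const 1), integral_const, probReal_univ, one_smul,
    integral_eq_lintegral_of_nonneg_ae (Eventually.of_forall hgnn) hgm.aestronglyMeasurable, hlint]

lemma IsLCProj.integral_le_expQuot [FiniteDimensional ℝ E] [MeasureSpace E] [BorelSpace E]
    [(volume : Measure E).IsAddHaarMeasure] {P : Measure E} (hP : MemP P) {fs : E → ℝ}
    (hfs : IsLCProj P fs) {Δ : E → EReal} (hΔ : Measurable Δ) (hbot : ∀ᵐ x ∂P, Δ x ≠ ⊥)
    (hint : Integrable (fun x => (Δ x).toReal) P) {t : ℝ} (ht : 0 < t)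
    (h : MemPhi fun x => elog (fs x) + (t : EReal) * Δ x) :
    ∫ x, (Δ x).toReal ∂P ≤
      ∫ x, expQuot t (Δ x) ∂(volume.withDensity fun x => ENNReal.ofReal (fs x)) := by
  have heq : ∀ᵐ x ∂P, elog (fs x) + (t : EReal) * Δ x =
      ((Real.log (fs x) + t * (Δ x).toReal : ℝ) : EReal) := by
    filter_upwards [hfs.2.1, hbot] with x hx hb
    rw [elog_of_pos hx, EReal.coe_add, EReal.coe_mul, EReal.coe_toReal (h.ne_top_of_pos ht hx) hb]
  have heq' : (fun x => Real.log (fs x) + t * (Δ x).toReal) =ᵐ[P]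
      fun x => (elog (fs x) + (t : EReal) * Δ x).toReal :=
    heq.mono fun x hx => ((congrArg EReal.toReal hx).trans (EReal.toReal_coe _)).symm
  obtain ⟨hZ, hle⟩ := hfs.integral_toReal_sub_log_le hP h
    (heq.mono fun x hx => by rw [hx]; exact EReal.coe_ne_bot _)
    ((hfs.2.2.1.add (hint.const_mul t)).congr heq')
  rw [← integral_congr_ae heq', integral_add hfs.2.2.1 (hint.const_mul t),
    integral_const_mul] at hle
  rw [(hfs.1.integral_expQuot hΔ ht h).2, le_div_iff₀ ht]
  linarith [Real.log_le_sub_one_of_pos hZ]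

lemma IsLCProj.integrable_toReal [FiniteDimensional ℝ E] [MeasureSpace E] [BorelSpace E]
    {P : Measure E} (hP : MemP P) {fs : E → ℝ} (hfs : IsLCProj P fs) {Δ : E → EReal}
    (hΔ : Measurable Δ) {t : ℝ} (ht : 0 < t)
    (h : MemPhi fun x => elog (fs x) + (t : EReal) * Δ x)
    (hneg : ∫⁻ x, epos (-Δ x) ∂P ≠ ⊤) :
    (∀ᵐ x ∂P, Δ x ≠ ⊥) ∧ Integrable (fun x => (Δ x).toReal) P := by
  have := hP.1
  have hm : Measurable fun x => epos (-Δ x) := measurable_epos.comp hΔ.neg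
  have hbot : ∀ᵐ x ∂P, Δ x ≠ ⊥ := by
    filter_upwards [ae_lt_top hm hneg] with x hx hb
    simp [hb, epos] at hx
  refine ⟨hbot, ?_⟩
  obtain ⟨a, b, -, hab⟩ := h.exists_le_sub_mul_norm
  have hU : Integrable (fun x => (b - a * ‖x‖ - Real.log (fs x)) / t) P :=
    (((integrable_const b).sub (hP.2.1.const_mul a)).sub hfs.2.2.1).div_const t
  refine (hU.norm.add (integrable_toReal_of_lintegral_ne_top hm.aemeasurable hneg)).mono'
    (measurable_ereal_toReal.comp hΔ).aestronglyMeasurable ?_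
  filter_upwards [hfs.2.1, hbot] with x hx hb
  obtain ⟨r, hr⟩ : ∃ r : ℝ, Δ x = r :=
    ⟨_, (EReal.coe_toReal (h.ne_top_of_pos ht hx) hb).symm⟩
  have h1 := hab x
  rw [elog_of_pos hx, hr, ← EReal.coe_mul, ← EReal.coe_add, EReal.coe_le_coe_iff] at h1
  have h2 : r ≤ (b - a * ‖x‖ - Real.log (fs x)) / t := by
    rw [le_div_iff₀ ht]
    linarith
  simp only [hr, Pi.add_apply, EReal.toReal_coe, ← EReal.coe_neg, epos_coe,
    ENNReal.toReal_ofReal', Real.norm_eq_abs]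
  rw [abs_le]
  have h3 := le_max_left (-r) 0
  have h4 := le_max_right (-r) 0
  have h5 := le_abs_self ((b - a * ‖x‖ - Real.log (fs x)) / t)
  have h6 := abs_nonneg ((b - a * ‖x‖ - Real.log (fs x)) / t)
  constructor <;> linarith

lemma IsLCProj.erealIntegral_le_of_measurable [FiniteDimensional ℝ E] [MeasureSpace E]
    [BorelSpace E] [(volume : Measure E).IsAddHaarMeasure] {P : Measure E} (hP : MemP P)
    {fs : E → ℝ} (hfs : IsLCProj P fs) {Δ : E → EReal} (hΔm : Measurable Δ) {t₁ : ℝ}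
    (ht₁ : 0 < t₁)
    (hΔ : ∀ t, 0 < t → t ≤ t₁ → MemPhi fun x => elog (fs x) + (t : EReal) * Δ x) :
    erealIntegral P Δ ≤
      erealIntegral (volume.withDensity fun x => ENNReal.ofReal (fs x)) Δ := by
  by_cases hneg : ∫⁻ x, epos (-Δ x) ∂P = ⊤
  · simp [erealIntegral, hneg]
  have h₁ := hΔ t₁ ht₁ le_rfl
  obtain ⟨hbot, hint⟩ := hfs.integrable_toReal hP hΔm ht₁ h₁ hneg
  have htopP : ∀ᵐ x ∂P, Δ x ≠ ⊤ := hfs.2.1.mono fun x hx => h₁.ne_top_of_pos ht₁ hx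
  have htop : ∀ᵐ x ∂(volume : Measure E).withDensity fun x => ENNReal.ofReal (fs x), Δ x ≠ ⊤ := by
    rw [ae_withDensity_iff hfs.1.1.2.1.ennreal_ofReal]
    refine Eventually.of_forall fun x hx => h₁.ne_top_of_pos ht₁ ?_
    simpa using hx
  obtain ⟨hbot', hint', hle⟩ := le_integral_toReal_of_le_integral_expQuot hΔm htop ht₁
    (fun t h0 h1 => (hfs.1.integral_expQuot hΔm h0 (hΔ t h0 h1)).1)
    (fun t h0 h1 => hfs.integral_le_expQuot hP hΔm hbot hint h0 (hΔ t h0 h1))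
  rw [erealIntegral_eq_integral_toReal htopP hbot hint,
    erealIntegral_eq_integral_toReal htop hbot' hint']
  exact EReal.coe_le_coe_iff.2 hle

/-- A perturbation of `log f` within `Φ` is measurable up to its values on `{f = 0}`. -/
lemma MemPhi.exists_measurable_eq [MeasurableSpace E] [BorelSpace E] {f : E → ℝ}
    (hf : Measurable f) {Δ : E → EReal} {t : ℝ} (ht : 0 < t)
    (h : MemPhi fun x => elog (f x) + (t : EReal) * Δ x) :
    ∃ Δ' : E → EReal, Measurable Δ' ∧ ∀ x, 0 < f x → Δ' x = Δ x := by
  refine ⟨fun x => if elog (f x) + (t : EReal) * Δ x = ⊥ then ⊥ else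
    (((elog (f x) + (t : EReal) * Δ x).toReal - Real.log (f x)) / t : ℝ), ?_, fun x hx => ?_⟩
  · refine Measurable.ite (h.measurable (measurableSet_singleton _)) measurable_const ?_
    exact measurable_coe_real_ereal.comp (((measurable_ereal_toReal.comp h.measurable).sub
      (Real.measurable_log.comp hf)).div_const t)
  · have htop := h.ne_top_of_pos ht hx
    simp only [elog_of_pos hx]
    by_cases hb : Δ x = ⊥
    · simp [hb, EReal.coe_mul_bot_of_pos ht]
    · lift Δ x to ℝ using ⟨htop, hb⟩ with r
      rw [← EReal.coe_mul, ← EReal.coe_add, if_neg (EReal.coe_ne_bot _), EReal.toReal_coe,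
        add_sub_cancel_left, mul_div_cancel_left₀ _ ht.ne']

end

/-- Variational characterisation of the log-concave projection: for any perturbation `Δ`
with `φ* + tΔ ∈ Φ` for all sufficiently small `t > 0`, one has `∫ Δ dP ≤ ∫ Δ dP*`. -/
theorem statement8 (d : ℕ) (P : Measure (Rd d)) (hP : MemP P)
    (fs : Rd d → ℝ) (hfs : IsLCProj P fs)
    (Δ : Rd d → EReal)
    (hΔ : ∃ t₀ : ℝ, 0 < t₀ ∧ ∀ t : ℝ, 0 < t → t < t₀ →
      MemPhi (fun x => elog (fs x) + ((t : ℝ) : EReal) * Δ x)) :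
    erealIntegral P Δ ≤
      erealIntegral (volume.withDensity fun x => ENNReal.ofReal (fs x)) Δ := by
  obtain ⟨t₀, ht₀, hΔ⟩ := hΔ
  obtain ⟨Δ', hΔm, hΔ'⟩ := (hΔ (t₀ / 2) (half_pos ht₀) (half_lt_self ht₀)).exists_measurable_eq
    hfs.1.1.2.1 (half_pos ht₀)
  have hP' : Δ =ᵐ[P] Δ' := hfs.2.1.mono fun x hx => (hΔ' x hx).symm
  have hfs' : Δ =ᵐ[volume.withDensity fun x => ENNReal.ofReal (fs x)] Δ' := by
    rw [EventuallyEq, ae_withDensity_iff hfs.1.1.2.1.ennreal_ofReal]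
    exact Eventually.of_forall fun x hx => (hΔ' x (by simpa using hx)).symm
  rw [erealIntegral_congr_ae hP', erealIntegral_congr_ae hfs']
  refine hfs.erealIntegral_le_of_measurable hP hΔm (half_pos ht₀) fun t h0 h1 => ?_
  convert hΔ t h0 (h1.trans_lt (half_lt_self ht₀)) using 2 with x
  by_cases hx : 0 < fs x
  · rw [hΔ' x hx]
  · simp [elog, not_lt.1 hx]
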